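/- Let A be a unital associative ℚ(q)-algebra and let x, w ∈ A satisfy xw = q²wx. Then for all n ∈ ℕ and t ∈ ℤ: C_q(x + (q − q^{−1})² w; t, n) = Σ_{r=0}^{n} q^{r(t−n)} (q − q^{−1})^r · {x; t − 2r | n, r} · w^{(r)}. -/

import Mathlib

open Finset

noncomputable section

/-- The base field `ℚ(q)` of rational functions over `ℚ`. -/
abbrev K : Type := RatFunc ℚ

/-- The indeterminate `q`. -/
def q : K := RatFunc.X

/-- The `x`-number `(n)_x = (x^n - 1)/(x - 1)`. -/
def qn (x : K) (n : ℕ) : K := (x ^ n - 1) / (x - 1)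

/-- The `x`-factorial `(n)_x!`. -/
def qnFact (x : K) (n : ℕ) : K := ∏ r ∈ Finset.Icc 1 n, qn x r

/-- The `x`-binomial coefficient `binom_x(n,s)`, zero when `s > n`. -/
def qBinom (x : K) (n s : ℕ) : K :=
  if s ≤ n then qnFact x n / (qnFact x s * qnFact x (n - s)) else 0

/-- The balanced `q`-integer `[n]_q = (q^n - q^{-n})/(q - q^{-1})`. -/
def qint (n : ℕ) : K := (q ^ n - q⁻¹ ^ n) / (q - q⁻¹)

/-- The balanced `q`-factorial `[n]_q!`. -/
def qintFact (n : ℕ) : K := ∏ r ∈ Finset.Icc 1 n, qint r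

variable {A : Type*} [Ring A] [Algebra K A]

/-- The `q`-divided power `X^{(n)} = X^n / [n]_q!`. -/
def dp (X : A) (n : ℕ) : A := (qintFact n)⁻¹ • X ^ n

/-- The `q`-binomial coefficient `C_q(X; c, n) = ∏_{s=1}^n (q^{c+1-s} X - 1)/(q^s - 1)`. -/
def Cq (X : A) (c : ℤ) : ℕ → A
  | 0 => 1
  | n + 1 => (q ^ ((n : ℤ) + 1) - 1)⁻¹ • (Cq X c n * (q ^ (c - (n : ℤ)) • X - 1))

/-- The bracket `{X; c | n, r} = Σ_{s=0}^r q^{s(s+1)/2} binom_q(r,s) C_q(X; c+s, n-r)`. -/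
def Sq (X : A) (c : ℤ) (n r : ℕ) : A :=
  ∑ s ∈ Finset.range (r + 1),
    (q ^ (s * (s + 1) / 2) * qBinom q r s) • Cq X (c + (s : ℤ)) (n - r)

end

lemma q_ne_zero : q ≠ 0 := RatFunc.X_ne_zero

lemma q_pow_ne_one {n : ℕ} (hn : n ≠ 0) : q ^ n ≠ 1 := by
  intro h
  have h' : algebraMap (Polynomial ℚ) K (Polynomial.X ^ n) = algebraMap (Polynomial ℚ) K 1 := by
    rw [map_pow, map_one, RatFunc.algebraMap_X]
    exact h
  have h'' := congrArg Polynomial.natDegree (RatFunc.algebraMap_injective ℚ h')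
  rw [Polynomial.natDegree_X_pow, Polynomial.natDegree_one] at h''
  exact hn h''

lemma q_pow_succ_sub_one_ne_zero (n : ℕ) : q ^ (n + 1) - 1 ≠ 0 :=
  sub_ne_zero.mpr (q_pow_ne_one n.succ_ne_zero)

lemma q_sub_one_ne_zero : q - 1 ≠ 0 := by
  simpa using q_pow_succ_sub_one_ne_zero 0

lemma q_sub_inv_ne_zero : q - q⁻¹ ≠ 0 := by
  have h := q_pow_succ_sub_one_ne_zero 1
  intro h0
  apply h
  have : q ^ (1 + 1) - 1 = (q - q⁻¹) * q := by
    field_simp [q_ne_zero]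
  rw [this, h0, zero_mul]

lemma qn_q_succ_ne_zero (n : ℕ) : qn q (n + 1) ≠ 0 :=
  div_ne_zero (q_pow_succ_sub_one_ne_zero n) q_sub_one_ne_zero

lemma qnFact_succ (x : K) (n : ℕ) : qnFact x (n + 1) = qnFact x n * qn x (n + 1) :=
  Finset.prod_Icc_succ_top (by omega) _

lemma qnFact_zero (x : K) : qnFact x 0 = 1 := by simp [qnFact]

lemma qnFact_q_ne_zero (n : ℕ) : qnFact q n ≠ 0 := by
  induction n with
  | zero => simp [qnFact_zero]
  | succ n ih => rw [qnFact_succ]; exact mul_ne_zero ih (qn_q_succ_ne_zero n)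

lemma qBinom_q_zero_right (n : ℕ) : qBinom q n 0 = 1 := by
  simp [qBinom, qnFact_zero, qnFact_q_ne_zero]

lemma qBinom_of_lt (x : K) {n s : ℕ} (h : n < s) : qBinom x n s = 0 :=
  if_neg (by omega)

lemma qBinom_q_self (n : ℕ) : qBinom q n n = 1 := by
  simp [qBinom, qnFact_zero, qnFact_q_ne_zero]

/-- The `q`-Pascal rule, with the top index written as `s + k + 1`. -/
lemma qBinom_q_add_succ_succ (s k : ℕ) :
    qBinom q (s + k + 1) (s + 1) = qBinom q (s + k) (s + 1) + q ^ k * qBinom q (s + k) s := by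
  cases k with
  | zero => simp [qBinom_q_self, qBinom_of_lt]
  | succ k =>
    have h1 : s + (k + 1) + 1 - (s + 1) = k + 1 := by omega
    have h2 : s + (k + 1) - (s + 1) = k := by omega
    have h3 : s + (k + 1) - s = k + 1 := by omega
    rw [qBinom, qBinom, qBinom, if_pos (by omega), if_pos (by omega), if_pos (by omega), h1, h2, h3,
      qnFact_succ q (s + (k + 1)), qnFact_succ q s, qnFact_succ q k]
    have hs := qnFact_q_ne_zero s
    have hk := qnFact_q_ne_zero k
    have hs' := qn_q_succ_ne_zero s
    have hk' := qn_q_succ_ne_zero k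
    have key : qn q (s + (k + 1) + 1) = qn q (k + 1) + q ^ (k + 1) * qn q (s + 1) := by
      simp only [qn]
      field_simp [q_sub_one_ne_zero]
      ring
    rw [key]
    field_simp

lemma qintFact_succ (n : ℕ) : qintFact (n + 1) = qintFact n * qint (n + 1) :=
  Finset.prod_Icc_succ_top (by omega) _

lemma qint_succ_ne_zero (n : ℕ) : qint (n + 1) ≠ 0 := by
  refine div_ne_zero ?_ q_sub_inv_ne_zero
  have h := q_pow_succ_sub_one_ne_zero (2 * n + 1)
  intro h0
  apply h
  have hq := pow_ne_zero (n + 1) q_ne_zero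
  have : q ^ (2 * n + 1 + 1) - 1 = (q ^ (n + 1) - q⁻¹ ^ (n + 1)) * q ^ (n + 1) := by
    rw [sub_mul, inv_pow, inv_mul_cancel₀ hq]
    ring
  rw [this, h0, zero_mul]

section

variable {A : Type*} [Ring A] [Algebra K A]

/-- The `ℕ`-algebra structure found on `K` is the one of `RatFunc`, which the general instance for
scalar towers over `ℕ` does not match. -/
instance natIsScalarTower :
    @IsScalarTower ℕ K A (inferInstance : Algebra ℕ K).toSMul _ _ :=
  @IsScalarTower.mk ℕ K A (inferInstance : Algebra ℕ K).toSMul _ _ fun n k a => by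
    rw [Algebra.smul_def n k, eq_natCast, mul_smul, Nat.cast_smul_eq_nsmul]

/-- The analogue of `natIsScalarTower` for `ℤ`. -/
instance intIsScalarTower :
    @IsScalarTower ℤ K A (inferInstance : Algebra ℤ K).toSMul _ _ :=
  @IsScalarTower.mk ℤ K A (inferInstance : Algebra ℤ K).toSMul _ _ fun n k a => by
    rw [Algebra.smul_def n k, eq_intCast, mul_smul, Int.cast_smul_eq_zsmul]

lemma Cq_zero (X : A) (c : ℤ) : Cq X c 0 = 1 := rfl

lemma smul_Cq_succ (X : A) (c : ℤ) (n : ℕ) :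
    (q ^ (n + 1) - 1) • Cq X c (n + 1) = q ^ (c - n) • (Cq X c n * X) - Cq X c n := by
  have h : q ^ ((n : ℤ) + 1) = q ^ (n + 1) := by exact_mod_cast zpow_natCast q (n + 1)
  rw [Cq, h, smul_smul, mul_inv_cancel₀ (q_pow_succ_sub_one_ne_zero n), one_smul, mul_sub,
    mul_smul_comm, mul_one]

/-- Pascal's rule for the `q`-binomial coefficients of an algebra element. -/
lemma Cq_add_one_succ (X : A) (c : ℤ) (m : ℕ) :
    Cq X (c + 1) (m + 1) = q ^ (m + 1) • Cq X c (m + 1) + Cq X c m := by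
  induction m with
  | zero =>
    have h := q_pow_succ_sub_one_ne_zero 0
    refine smul_right_injective A h ?_
    have h1 := smul_Cq_succ X (c + 1) 0
    have h2 := smul_Cq_succ X c 0
    have e : q ^ (c + 1) = q ^ c * q := zpow_add_one₀ q_ne_zero c
    simp only [Nat.cast_zero, sub_zero, Cq_zero, one_mul, e] at h1 h2 ⊢
    linear_combination (norm := module) h1 - q • h2
  | succ m ih =>
    refine smul_right_injective A (q_pow_succ_sub_one_ne_zero (m + 1)) ?_
    have h1 := smul_Cq_succ X (c + 1) (m + 1)
    have h2 := smul_Cq_succ X c (m + 1)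
    have h3 := smul_Cq_succ X c m
    have e1 : q ^ (c + 1 - ((m + 1 : ℕ) : ℤ)) = q ^ (c - ((m + 1 : ℕ) : ℤ)) * q := by
      rw [← zpow_add_one₀ q_ne_zero]; congr 1; ring
    have e2 : q ^ (c - (m : ℤ)) = q ^ (c - ((m + 1 : ℕ) : ℤ)) * q := by
      rw [← zpow_add_one₀ q_ne_zero]; congr 1; push_cast; ring
    rw [ih, add_mul, smul_mul_assoc, e1] at h1
    rw [e2] at h3
    linear_combination (norm := module) h1 - q ^ (m + 2) • h2 - h3

/-- The bracket `{X; c | m + r, r}`, by its recursion in `r`. -/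
noncomputable def bracket (X : A) (m : ℕ) : ℕ → ℤ → A
  | 0, c => Cq X c m
  | r + 1, c => bracket X m r c + q ^ (r + 1) • bracket X m r (c + 1)

lemma sum_qBinom_smul_Cq_eq_bracket (X : A) (m r : ℕ) (c : ℤ) :
    ∑ s ∈ range (r + 1), (q ^ (s * (s + 1) / 2) * qBinom q r s) • Cq X (c + (s : ℤ)) m =
      bracket X m r c := by
  induction r generalizing c with
  | zero => simp [bracket, qBinom_q_zero_right]
  | succ r ih =>
    rw [bracket, ← ih c, Finset.sum_range_succ' _ r, ← ih (c + 1), Finset.sum_range_succ' _ (r + 1),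
      smul_sum]
    have hterm : ∀ s ∈ range (r + 1),
        (q ^ ((s + 1) * (s + 1 + 1) / 2) * qBinom q (r + 1) (s + 1)) •
            Cq X (c + ((s + 1 : ℕ) : ℤ)) m =
          (q ^ ((s + 1) * (s + 1 + 1) / 2) * qBinom q r (s + 1)) • Cq X (c + ((s + 1 : ℕ) : ℤ)) m +
          q ^ (r + 1) • (q ^ (s * (s + 1) / 2) * qBinom q r s) • Cq X (c + 1 + (s : ℤ)) m := by
      intro s hs
      obtain ⟨k, rfl⟩ := Nat.exists_eq_add_of_le (Nat.lt_succ_iff.mp (mem_range.mp hs))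
      have e1 : (s + 1) * (s + 1 + 1) / 2 = s * (s + 1) / 2 + (s + 1) := by
        rw [show (s + 1) * (s + 1 + 1) = s * (s + 1) + (s + 1) * 2 by ring,
          Nat.add_mul_div_right _ _ two_pos]
      have e2 : c + ((s + 1 : ℕ) : ℤ) = c + 1 + (s : ℤ) := by push_cast; ring
      rw [qBinom_q_add_succ_succ, e1, e2, smul_smul, ← add_smul]
      congr 1
      ring
    rw [sum_congr rfl hterm, sum_add_distrib, Finset.sum_range_succ,
      qBinom_of_lt q (Nat.lt_succ_self r)]
    simp only [qBinom_q_zero_right, mul_zero, zero_smul, add_zero]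
    abel

lemma Sq_eq_bracket (X : A) (c : ℤ) (n r : ℕ) : Sq X c n r = bracket X (n - r) r c :=
  sum_qBinom_smul_Cq_eq_bracket X (n - r) r c

lemma bracket_add_one_succ (X : A) (m r : ℕ) (c : ℤ) :
    bracket X (m + 1) r (c + 1) = q ^ (m + 1) • bracket X (m + 1) r c + bracket X m r c := by
  induction r generalizing c with
  | zero => exact Cq_add_one_succ X c m
  | succ r ih =>
    have h1 := ih c
    have h2 := ih (c + 1)
    simp only [bracket]
    linear_combination (norm := module) h1 + q ^ (r + 1) • h2

lemma bracket_zero_succ (X : A) (r : ℕ) (c d : ℤ) :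
    bracket X 0 (r + 1) c = (1 + q ^ (r + 1)) • bracket X 0 r d := by
  have h : ∀ r c d, bracket X 0 r c = bracket X 0 r d := by
    intro r
    induction r with
    | zero => intro c d; rfl
    | succ r ih => intro c d; rw [bracket, bracket, ih c d, ih (c + 1) (d + 1)]
  rw [bracket, h r c d, h r (c + 1) d, add_smul, one_smul]

lemma smul_bracket_succ_left (X : A) (m r : ℕ) (c : ℤ) :
    (q ^ (m + r + 2) - 1) • bracket X (m + 1) (r + 1) c =
      q ^ (c - m) • (bracket X m (r + 1) c * X) - q ^ (r + 1) • bracket X m (r + 1) c +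
        (q ^ (2 * (r + 1)) - 1) • bracket X (m + 1) r (c + 2) := by
  induction r generalizing c with
  | zero =>
    have h1 := smul_Cq_succ X c m
    have h2 := smul_Cq_succ X (c + 1) m
    have p1 := Cq_add_one_succ X c m
    have p2 := Cq_add_one_succ X (c + 1) m
    have e : q ^ (c + 1 - (m : ℤ)) = q ^ (c - (m : ℤ)) * q := by
      rw [← zpow_add_one₀ q_ne_zero]; congr 1; ring
    rw [e] at h2
    rw [add_assoc, one_add_one_eq_two] at p2
    simp only [bracket, add_mul, smul_mul_assoc]
    linear_combination (norm := module) h1 + h2 - (q - 1) • p1 - (q ^ 2 - 1) • p2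
  | succ r ih =>
    have h1 := ih c
    have h2 := ih (c + 1)
    have p1 := bracket_add_one_succ X m (r + 1) c
    have p2 := bracket_add_one_succ X m (r + 1) (c + 1)
    have d := bracket.eq_2 X (m + 1) (c + 2) r
    have e : q ^ (c + 1 - (m : ℤ)) = q ^ (c - (m : ℤ)) * q := by
      rw [← zpow_add_one₀ q_ne_zero]; congr 1; ring
    rw [e] at h2
    rw [add_assoc c 1 1, one_add_one_eq_two] at p2
    rw [add_right_comm c 1 2] at h2
    rw [bracket.eq_2 X (m + 1) c (r + 1), bracket.eq_2 X m c (r + 1)]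
    simp only [add_mul, smul_mul_assoc]
    linear_combination (norm := module) h1 + q ^ (r + 1) • h2 - (q ^ (r + 1) * (q - 1)) • p1 -
      (q ^ (2 * (r + 1)) * (q ^ 2 - 1)) • p2 - (q ^ (2 * (r + 1)) - 1) • d

lemma pow_mul_of_q_commute {x w : A} (hxw : x * w = (q ^ 2 : K) • (w * x)) (r : ℕ) :
    q ^ (2 * r) • (w ^ r * x) = x * w ^ r := by
  induction r with
  | zero => simp
  | succ r ih =>
    rw [pow_succ, ← mul_assoc x, ← ih, smul_mul_assoc, mul_assoc (w ^ r) x, hxw, mul_smul_comm,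
      smul_smul, mul_assoc]
    congr 1
    ring

/-- The scalar `q^{r(t-n)} (q - q⁻¹)^r / [r]_q!`. -/
noncomputable def expansionCoeff (t : ℤ) (n r : ℕ) : K :=
  q ^ ((r : ℤ) * (t - n)) * (q - q⁻¹) ^ r * (qintFact r)⁻¹

lemma expansionCoeff_zero (t : ℤ) (n : ℕ) : expansionCoeff t n 0 = 1 := by
  simp [expansionCoeff, qintFact]

lemma pow_mul_expansionCoeff_succ (t : ℤ) (n r : ℕ) :
    q ^ r * expansionCoeff t (n + 1) r = expansionCoeff t n r := by
  have h : q ^ ((r : ℤ) * (t - n)) = q ^ r * q ^ ((r : ℤ) * (t - (n + 1 : ℕ))) := by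
    rw [← zpow_natCast, ← zpow_add₀ q_ne_zero]; congr 1; push_cast; ring
  rw [expansionCoeff, expansionCoeff, h]
  ring

lemma expansionCoeff_mul_zpow (t : ℤ) (n r : ℕ) :
    q ^ (t - n) * (q - q⁻¹) ^ 2 * expansionCoeff t n r =
      (q ^ (r + 1) - q⁻¹ ^ (r + 1)) * expansionCoeff t n (r + 1) := by
  have h : q ^ (((r + 1 : ℕ) : ℤ) * (t - n)) = q ^ (t - n) * q ^ ((r : ℤ) * (t - n)) := by
    rw [← zpow_add₀ q_ne_zero]; congr 1; push_cast; ring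
  have hq : q ^ (r + 1) - q⁻¹ ^ (r + 1) = qint (r + 1) * (q - q⁻¹) :=
    (div_mul_cancel₀ _ q_sub_inv_ne_zero).symm
  have hr := qint_succ_ne_zero r
  rw [expansionCoeff, expansionCoeff, h, hq, qintFact_succ, mul_inv]
  linear_combination (-(q ^ (t - n) * (q - q⁻¹) ^ (r + 2) * q ^ ((r : ℤ) * (t - n)) *
    (qintFact r)⁻¹)) * mul_inv_cancel₀ hr

/-- The coefficients of the last two terms in the recursion for `expansionTerm`. -/
lemma pow_mul_expansionCoeff_mul_zpow (t : ℤ) (n r : ℕ) :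
    q ^ (t - n) * (q - q⁻¹) ^ 2 * expansionCoeff t n r =
      (q ^ (2 * (r + 1)) - 1) * expansionCoeff t (n + 1) (r + 1) := by
  have h : q⁻¹ ^ (r + 1) * q ^ (r + 1) = 1 := by
    rw [← mul_pow, inv_mul_cancel₀ q_ne_zero, one_pow]
  rw [expansionCoeff_mul_zpow, ← pow_mul_expansionCoeff_succ]
  linear_combination -(expansionCoeff t (n + 1) (r + 1)) * h

/-- The `r`-th term of the expansion of `C_q(x + (q - q⁻¹)² w; t, n)`, zero when `r > n`. -/
noncomputable def expansionTerm (x w : A) (t : ℤ) (n r : ℕ) : A :=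
  if r ≤ n then expansionCoeff t n r • (bracket x (n - r) r (t - 2 * r) * w ^ r) else 0

lemma smul_expansionTerm_zero (x w : A) (t : ℤ) (n : ℕ) :
    (q ^ (n + 1) - 1) • expansionTerm x w t (n + 1) 0 =
      expansionTerm x w t n 0 * (q ^ (t - n) • x - 1) := by
  simpa [expansionTerm, expansionCoeff_zero, bracket, mul_sub] using smul_Cq_succ x t n

lemma smul_expansionTerm_succ {x w : A} (hxw : x * w = (q ^ 2 : K) • (w * x)) (t : ℤ)
    {n r : ℕ} (hr : r ≤ n) :
    (q ^ (n + 1) - 1) • expansionTerm x w t (n + 1) (r + 1) =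
      expansionTerm x w t n (r + 1) * (q ^ (t - n) • x - 1) +
        (q ^ (t - n) * (q - q⁻¹) ^ 2) • (expansionTerm x w t n r * w) := by
  have hc : t - 2 * (r : ℤ) = t - 2 * ((r + 1 : ℕ) : ℤ) + 2 := by push_cast; ring
  have hlast := pow_mul_expansionCoeff_mul_zpow t n r
  rw [expansionTerm, expansionTerm, expansionTerm, if_pos (by omega), if_pos hr, smul_mul_assoc,
    smul_smul (q ^ (t - (n : ℤ)) * _), hlast, mul_assoc _ (w ^ r), ← pow_succ, Nat.add_sub_add_right]
  rcases hr.eq_or_lt with rfl | hlt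
  · rw [if_neg (by omega), Nat.sub_self,
      bracket_zero_succ x r (t - 2 * ((r + 1 : ℕ) : ℤ)) (t - 2 * (r : ℤ)), smul_mul_assoc,
      zero_mul]
    module
  · obtain ⟨m, rfl⟩ := Nat.exists_eq_add_of_le' (show r + 1 ≤ n from hlt)
    have h1 : m + (r + 1) - r = m + 1 := by omega
    have h2 : m + (r + 1) - (r + 1) = m := by omega
    rw [if_pos (by omega), h1, h2, hc]
    set c := t - 2 * ((r + 1 : ℕ) : ℤ) with hc_def
    have hrec := congrArg (· * w ^ (r + 1)) (smul_bracket_succ_left x m r c)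
    simp only [sub_mul, add_mul, smul_mul_assoc, mul_assoc] at hrec
    have hcomm := pow_mul_of_q_commute hxw (r + 1)
    rw [← hcomm, mul_smul_comm] at hrec
    have hz : q ^ (c - m) * q ^ (2 * (r + 1)) =
        q ^ (t - ((m + (r + 1) : ℕ) : ℤ)) * q ^ (r + 1) := by
      rw [← zpow_natCast, ← zpow_natCast q (r + 1), ← zpow_add₀ q_ne_zero, ← zpow_add₀ q_ne_zero,
        hc_def]
      congr 1; push_cast; ring
    rw [smul_smul, hz] at hrec
    rw [← pow_mul_expansionCoeff_succ t (m + (r + 1)) (r + 1)]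
    simp only [mul_sub, mul_one, smul_mul_assoc, mul_smul_comm, mul_assoc (bracket x m (r + 1) c)]
    linear_combination (norm := module) expansionCoeff t (m + (r + 1) + 1) (r + 1) • hrec

lemma Cq_add_smul_eq_sum_expansionTerm {x w : A} (hxw : x * w = (q ^ 2 : K) • (w * x)) (t : ℤ)
    (n : ℕ) :
    Cq (x + ((q - q⁻¹) ^ 2 : K) • w) t n = ∑ r ∈ range (n + 1), expansionTerm x w t n r := by
  induction n with
  | zero => simp [expansionTerm, expansionCoeff_zero, bracket, Cq_zero]
  | succ n ih =>
    refine smul_right_injective A (q_pow_succ_sub_one_ne_zero n) ?_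
    have hshift : ∑ r ∈ range (n + 1), expansionTerm x w t n (r + 1) =
        ∑ r ∈ range (n + 1), expansionTerm x w t n r - expansionTerm x w t n 0 := by
      have hzero : expansionTerm x w t n (n + 1) = 0 := if_neg (by omega)
      rw [eq_sub_iff_add_eq, ← Finset.sum_range_succ', Finset.sum_range_succ, hzero, add_zero]
    have hstep := sum_congr rfl fun r (hr : r ∈ range (n + 1)) =>
      smul_expansionTerm_succ hxw t (Nat.lt_succ_iff.mp (mem_range.mp hr))
    rw [sum_add_distrib, ← sum_mul, ← smul_sum, ← smul_sum, ← sum_mul, hshift, ← ih] at hstep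
    have hzero := smul_expansionTerm_zero x w t n
    simp only
    rw [smul_Cq_succ, Finset.sum_range_succ', smul_add, hstep, hzero]
    simp only [mul_add, sub_mul, mul_sub, mul_smul_comm, mul_one]
    module

end

theorem statement3 {A : Type*} [Ring A] [Algebra K A] (x w : A)
    (hxw : x * w = (q ^ 2 : K) • (w * x)) (n : ℕ) (t : ℤ) :
    Cq (x + ((q - q⁻¹) ^ 2 : K) • w) t n =
      ∑ r ∈ Finset.range (n + 1),
        (q ^ ((r : ℤ) * (t - (n : ℤ))) * (q - q⁻¹) ^ r) •
          (Sq x (t - 2 * (r : ℤ)) n r * dp w r) := by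
  rw [Cq_add_smul_eq_sum_expansionTerm hxw]
  refine sum_congr rfl fun r hr => ?_
  rw [expansionTerm, if_pos (Nat.lt_succ_iff.mp (mem_range.mp hr)), expansionCoeff, Sq_eq_bracket,
    dp, mul_smul_comm, smul_smul]
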